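/- Let N ≥ 2, r > 0, δ ∈ πrℤ, 0 < t < t* < ∞, and let w = (w_1,…,w_N) ∈ ℝ^N. Then ∫_{ℝ^N} [∏_{j=1}^N (e^{−w̃_j²/(2t)}/√(2πt))] · ϑ1( (δ + Σ_{j=1}^N (w_j + i·w̃_j))/(2πr) ; iNt*/(2πr²) ) · ∏_{1≤j<k≤N} ϑ1( ((w_j + i·w̃_j) − (w_k + i·w̃_k))/(2πr) ; iNt*/(2πr²) ) dw̃_1⋯dw̃_N = [ e^{Nt/(24r²)} · ∏_{n=1}^∞ (1 − e^{−nN(t*−t)/r²})/(1 − e^{−nNt*/r²}) ]^{−(N−1)(N−2)/2} · ϑ1( (δ + Σ_{j=1}^N w_j)/(2πr) ; iN(t*−t)/(2πr²) ) · ∏_{1≤j<k≤N} ϑ1( (w_j − w_k)/(2πr) ; iN(t*−t)/(2πr²) ). -/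

import Mathlib

/-- The Jacobi theta function
`ϑ1(v;τ) = i ∑_{n ∈ ℤ} (-1)^n e^{iπτ(n-1/2)^2} e^{iπ(2n-1)v}`. -/
noncomputable def theta1 (v τ : ℂ) : ℂ :=
  Complex.I * ∑' n : ℤ, (-1 : ℂ) ^ n *
    Complex.exp (Real.pi * Complex.I * τ * ((n : ℂ) - 1 / 2) ^ 2) *
    Complex.exp (Real.pi * Complex.I * (2 * (n : ℂ) - 1) * v)

section Helpers

open Complex Filter Topology


lemma summ_quad (A B C : ℂ) (hA : A.re < 0) :
    Summable (fun n : ℤ => cexp (A * (n:ℂ)^2 + B * n + C)) := by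
  have h := (summable_jacobiTheta₂_term_iff (B / (2 * Real.pi * I)) (A / (Real.pi * I))).2 (by
    have : A / (Real.pi * I) = (-(A/Real.pi)) * I := by
      have : (Real.pi:ℂ) ≠ 0 := by exact_mod_cast Real.pi_ne_zero
      field_simp
      simp
    rw [this]
    simp only [mul_im, neg_re, neg_im, I_re, I_im, div_ofReal_re]
    have := div_neg_of_neg_of_pos hA Real.pi_pos
    linarith)
  refine (h.mul_right (cexp C)).congr (fun n => ?_)
  rw [jacobiTheta₂_term, ← Complex.exp_add]
  congr 1
  have : (Real.pi:ℂ) ≠ 0 := by exact_mod_cast Real.pi_ne_zero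
  field_simp
  ring

lemma hs_congr {ι : Type*} {f g : ι → ℂ} {a b : ℂ} (h : HasSum f a) (hf : ∀ k, g k = f k) (hb : b = a) :
    HasSum g b := by
  have : g = f := funext hf
  rw [this, hb]; exact h

noncomputable def pp (h : ℝ) (n : ℕ) : ℝ := ∏ i ∈ Finset.range n, (1 - Real.exp (-h * (i+1)))

noncomputable def iv (h : ℝ) (j : ℤ) : ℝ := if 0 ≤ j then (pp h j.toNat)⁻¹ else 0

noncomputable def EE (h : ℝ) : ℝ := ∏' i : ℕ, (1 - Real.exp (-h * (i+1)))

lemma fac_pos {h : ℝ} (hh : 0 < h) (i : ℕ) : 0 < 1 - Real.exp (-h * (i+1)) := by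
  have : Real.exp (-h * (i+1)) < 1 := by
    rw [Real.exp_lt_one_iff]
    have : 0 < h * ((i:ℝ)+1) := by positivity
    linarith
  linarith

lemma summ_fac {h : ℝ} (hh : 0 < h) : Summable (fun i : ℕ => Real.exp (-h * (i+1))) := by
  have h1 : Summable (fun i : ℕ => (Real.exp (-h)) ^ i) :=
    summable_geometric_of_lt_one (Real.exp_pos _).le (by rw [Real.exp_lt_one_iff]; linarith)
  refine (h1.mul_left (Real.exp (-h))).congr (fun i => ?_)
  rw [← Real.exp_nat_mul, ← Real.exp_add]
  congr 1; ring

lemma mult_fac {h : ℝ} (hh : 0 < h) : Multipliable (fun i : ℕ => (1 - Real.exp (-h * (i+1)))) := by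
  simpa [sub_eq_add_neg] using Real.multipliable_one_add_of_summable (summ_fac hh).neg

lemma pp_pos {h : ℝ} (hh : 0 < h) (n : ℕ) : 0 < pp h n :=
  Finset.prod_pos (fun i _ => fac_pos hh i)

lemma pp_tendsto {h : ℝ} (hh : 0 < h) : Tendsto (pp h) atTop (𝓝 (EE h)) :=
  (mult_fac hh).hasProd.tendsto_prod_nat

lemma pp_anti {h : ℝ} (hh : 0 < h) : Antitone (pp h) := by
  refine antitone_nat_of_succ_le (fun n => ?_)
  rw [pp, Finset.prod_range_succ]
  have := pp_pos hh n
  have h2 := Real.exp_pos (-h * (n+1))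
  change pp h n * _ ≤ pp h n
  nlinarith

lemma EE_pos {h : ℝ} (hh : 0 < h) : 0 < EE h := by
  have h0 : 0 ≤ EE h := ge_of_tendsto' (pp_tendsto hh) (fun n => (pp_pos hh n).le)
  refine lt_of_le_of_ne h0 (Ne.symm ?_)
  have := tprod_one_add_ne_zero_of_summable (f := fun i : ℕ => - Real.exp (-h * (i+1)))
    (fun i => by have := fac_pos hh i; simpa [sub_eq_add_neg] using this.ne')
    (by simpa using (summ_fac hh))
  simpa [EE, sub_eq_add_neg] using this

lemma iv_rec {h : ℝ} (hh : 0 < h) (j : ℤ) : iv h (j-1) = (1 - Real.exp (-h*j)) * iv h j := by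
  rcases lt_trichotomy j 0 with hj | hj | hj
  · rw [iv, iv, if_neg (by omega), if_neg (by omega)]; simp
  · subst hj; simp [iv]
  · obtain ⟨n, rfl⟩ : ∃ n : ℕ, j = n + 1 := ⟨(j-1).toNat, by omega⟩
    rw [iv, iv, if_pos (by omega), if_pos (by omega)]
    have e1 : ((n:ℤ)+1-1).toNat = n := by omega
    have e2 : ((n:ℤ)+1).toNat = n+1 := by omega
    rw [e1, e2, pp, pp, Finset.prod_range_succ]
    have := fac_pos hh n
    have h3 := pp_pos hh n
    rw [pp] at h3
    push_cast
    rw [mul_inv, mul_comm, mul_assoc, inv_mul_cancel₀ this.ne', mul_one]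

lemma iv_nonneg {h : ℝ} (hh : 0 < h) (j : ℤ) : 0 ≤ iv h j := by
  rw [iv]; split_ifs
  · exact inv_nonneg.2 (pp_pos hh _).le
  · rfl

lemma iv_le {h : ℝ} (hh : 0 < h) (j : ℤ) : iv h j ≤ (EE h)⁻¹ := by
  rw [iv]; split_ifs
  · exact inv_anti₀ (EE_pos hh) ((pp_anti hh).le_of_tendsto (pp_tendsto hh) _)
  · exact inv_nonneg.2 (EE_pos hh).le

lemma iv_tendsto {h : ℝ} (hh : 0 < h) (k : ℤ) :
    Tendsto (fun n : ℕ => iv h (n + k)) atTop (𝓝 (EE h)⁻¹) := by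
  have h1 : Tendsto (fun n : ℕ => ((n:ℤ)+k).toNat) atTop atTop := by
    refine tendsto_atTop.2 (fun b => ?_)
    filter_upwards [eventually_ge_atTop (b + k.natAbs)] with n hn
    omega
  refine (((pp_tendsto hh).comp h1).inv₀ (EE_pos hh).ne').congr' ?_
  filter_upwards [eventually_ge_atTop (k.natAbs)] with n hn
  rw [iv, if_pos (by omega)]; rfl

/-- coefficient -/
noncomputable def tc (h : ℝ) (k : ℤ) : ℝ := (-1)^k * Real.exp (-h * (k*(k-1)/2))

lemma tc_succ (h : ℝ) (k : ℤ) : tc h (k+1) = - Real.exp (-h*k) * tc h k := by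
  rw [tc, tc, zpow_add₀ (by norm_num)]
  have : Real.exp (-h * (((k+1:ℤ):ℝ)*(((k+1:ℤ):ℝ)-1)/2)) = Real.exp (-h*k) * Real.exp (-h * (k*(k-1)/2)) := by
    rw [← Real.exp_add]; congr 1; push_cast; ring
  rw [this]; ring

noncomputable def ac (h : ℝ) (n : ℕ) (k : ℤ) : ℝ :=
  tc h k * (pp h (2*n) * iv h (n+k) * iv h (n-k))

lemma ac_succ {h : ℝ} (hh : 0 < h) (n : ℕ) (k : ℤ) :
    ac h (n+1) k = (1 + Real.exp (-h*(2*n+1))) * ac h n k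
      - Real.exp (-h*n) * ac h n (k-1) - Real.exp (-h*(n+1)) * ac h n (k+1) := by
  have hA1 : iv h (n+k) = (1 - Real.exp (-h*(n+1+k))) * iv h (n+1+k) := by
    have := iv_rec hh (n+1+k)
    rw [show (n:ℤ)+1+k-1 = n+k by ring] at this
    rw [this]; push_cast; rfl
  have hA2 : iv h (n+(k-1)) = (1 - Real.exp (-h*(n+k))) * iv h (n+k) := by
    have := iv_rec hh (n+k)
    rw [show (n:ℤ)+k-1 = n+(k-1) by ring] at this
    rw [this]; push_cast; rfl
  have hB1 : iv h (n-k) = (1 - Real.exp (-h*(n+1-k))) * iv h (n+1-k) := by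
    have := iv_rec hh (n+1-k)
    rw [show (n:ℤ)+1-k-1 = n-k by ring] at this
    rw [this]; push_cast; rfl
  have hB2 : iv h (n-(k+1)) = (1 - Real.exp (-h*(n-k))) * iv h (n-k) := by
    have := iv_rec hh (n-k)
    rw [show (n:ℤ)-k-1 = n-(k+1) by ring] at this
    rw [this]; push_cast; rfl
  have hP : pp h (2*(n+1)) = pp h (2*n) * (1 - Real.exp (-h*(2*n+1))) * (1 - Real.exp (-h*(2*n+2))) := by
    rw [show 2*(n+1) = 2*n+1+1 by ring, pp, Finset.prod_range_succ, Finset.prod_range_succ]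
    push_cast
    rw [pp]
    ring_nf
  have ht1 := tc_succ h k
  have ht2 : tc h (k-1) = - Real.exp (h*(k-1)) * tc h k := by
    have := tc_succ h (k-1)
    rw [show k-1+1 = k by ring] at this
    rw [this]
    push_cast
    have : Real.exp (h*(k-1)) * Real.exp (-h*(k-1)) = 1 := by rw [← Real.exp_add]; simp
    linear_combination (-tc h (k-1)) * this
  simp only [ac]
  rw [hP, ht1, ht2]
  rw [show ((n:ℤ) - (k-1)) = n+1-k by ring, show ((n:ℤ) + (k+1)) = n+1+k by ring, hA2, hB2, hA1, hB1]
  push_cast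
  set A := iv h (n+1+k)
  set B := iv h (n+1-k)
  set X := Real.exp (-h*n) with hX
  set p := Real.exp (-h) with hp
  set Y := Real.exp (-h*k) with hY
  set Z := Real.exp (h*k) with hZ
  have hYZ : Y * Z = 1 := by rw [hY, hZ, ← Real.exp_add]; simp
  have e1 : Real.exp (-h*(2*n+1)) = X^2*p := by
    rw [hX, hp, ← Real.exp_nat_mul, ← Real.exp_add]; congr 1; push_cast; ring
  have e2 : Real.exp (-h*(2*n+2)) = X^2*p^2 := by
    rw [hX, hp, ← Real.exp_nat_mul, ← Real.exp_nat_mul, ← Real.exp_add]; congr 1; push_cast; ring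
  have e3 : Real.exp (-h*(n+1+k)) = X*p*Y := by
    rw [hX, hp, hY, ← Real.exp_add, ← Real.exp_add]; congr 1; ring
  have e4 : Real.exp (-h*(n+k)) = X*Y := by
    rw [hX, hY, ← Real.exp_add]; congr 1; ring
  have e5 : Real.exp (-h*(n+1-k)) = X*p*Z := by
    rw [hX, hp, hZ, ← Real.exp_add, ← Real.exp_add]; congr 1; ring
  have e6 : Real.exp (-h*(n-k)) = X*Z := by
    rw [hX, hZ, ← Real.exp_add]; congr 1; ring
  have e7 : Real.exp (h*(k-1)) = Z*p := by
    rw [hp, hZ, ← Real.exp_add]; congr 1; ring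
  have e8 : Real.exp (-h*(n+1)) = X*p := by
    rw [hX, hp, ← Real.exp_add]; congr 1; ring
  rw [e1, e2, e3, e4, e5, e6, e7, e8]
  linear_combination (tc h k * pp h (2*n) * A * B *
    (2*X^2*p + X^2*p^2 - X^4*p^3 - X^3*p^2*(Y+Z))) * hYZ

lemma fin_triple {h : ℝ} (hh : 0 < h) {u : ℂ} (hu : u ≠ 0) (n : ℕ) :
    HasSum (fun k : ℤ => (ac h n k : ℂ) * u^k)
      (∏ i ∈ Finset.range n, ((1 - u * Real.exp (-h*i)) * (1 - u⁻¹ * Real.exp (-h*(i+1))))) := by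
  induction n with
  | zero =>
    have := hasSum_single (f := fun k : ℤ => (ac h 0 k : ℂ) * u^k) 0 (fun k hk => by
      have : ac h 0 k = 0 := by
        rw [ac]
        rcases lt_or_gt_of_ne hk with hk | hk
        · rw [iv, if_neg (by push_cast; omega)]; simp
        · rw [iv, iv, if_neg (c := 0 ≤ ((0:ℕ):ℤ) - k) (by push_cast; omega)]; simp
      simp [this])
    simpa [ac, tc, iv, pp] using this
  | succ n ih =>
    rw [Finset.prod_range_succ]
    set S := (∏ i ∈ Finset.range n, ((1 - u * Real.exp (-h*i)) * (1 - u⁻¹ * Real.exp (-h*(i+1)))) : ℂ)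
      with hS
    have h1 : HasSum (fun k : ℤ => (ac h n (k-1) : ℂ) * u^k) (u * S) := by
      have := ((Equiv.subRight (1:ℤ)).hasSum_iff.2 ih).mul_left u
      refine hs_congr this (fun k => ?_) rfl
      simp only [Function.comp, Equiv.subRight_apply]
      rw [zpow_sub₀ hu]; field_simp
    have h2 : HasSum (fun k : ℤ => (ac h n (k+1) : ℂ) * u^k) (u⁻¹ * S) := by
      have := ((Equiv.addRight (1:ℤ)).hasSum_iff.2 ih).mul_left u⁻¹
      refine hs_congr this (fun k => ?_) rfl
      simp only [Function.comp, Equiv.coe_addRight]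
      rw [zpow_add₀ hu]; field_simp
    have h3 := ((ih.mul_left ((1 + Real.exp (-h*(2*n+1)) : ℝ):ℂ)).sub
      (h1.mul_left ((Real.exp (-h*n) : ℝ):ℂ))).sub (h2.mul_left ((Real.exp (-h*(n+1)) : ℝ):ℂ))
    refine hs_congr h3 (fun k => ?_) ?_
    · rw [ac_succ hh]; push_cast; ring
    · have e1 : Real.exp (-h*(2*n+1)) = Real.exp (-h*n) * Real.exp (-h*(n+1)) := by
        rw [← Real.exp_add]; congr 1; ring
      rw [e1]
      push_cast
      field_simp
      ring

noncomputable def JJ (h : ℝ) (u : ℂ) : ℂ := ∑' k : ℤ, (tc h k : ℂ) * u^k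

lemma tc_eq {h : ℝ} {u : ℂ} (hu : u ≠ 0) (k : ℤ) : (tc h k : ℂ) * u^k =
    cexp (((-h/2 : ℝ):ℂ) * (k:ℂ)^2 + (h/2 + Real.pi * I + Complex.log u) * k + 0) := by
  have h1 : u^k = cexp (Complex.log u * k) := by
    rw [mul_comm, Complex.exp_int_mul, Complex.exp_log hu]
  have h2 : ((-1:ℂ))^k = cexp (Real.pi * I * k) := by
    rw [mul_comm, Complex.exp_int_mul, Complex.exp_pi_mul_I]
  rw [tc, h1]
  push_cast
  rw [h2, ← Complex.exp_add, ← Complex.exp_add]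
  congr 1; ring

lemma JJ_summ {h : ℝ} (hh : 0 < h) {u : ℂ} (hu : u ≠ 0) :
    Summable (fun k : ℤ => (tc h k : ℂ) * u^k) :=
  (summ_quad ((-h/2 : ℝ):ℂ) (h/2 + Real.pi * I + Complex.log u) 0
    (by rw [Complex.ofReal_re]; linarith)).congr (fun k => (tc_eq hu k).symm)

lemma triple_lim {h : ℝ} (hh : 0 < h) {u : ℂ} (hu : u ≠ 0) :
    Tendsto (fun n => ∏ i ∈ Finset.range n, ((1 - u * Real.exp (-h*i)) * (1 - u⁻¹ * Real.exp (-h*(i+1)))))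
      atTop (𝓝 (((EE h)⁻¹ : ℝ) * JJ h u)) := by
  have key : Tendsto (fun n => ∑' k : ℤ, (ac h n k : ℂ) * u^k) atTop
      (𝓝 (∑' k : ℤ, ((EE h)⁻¹ : ℝ) * ((tc h k : ℂ) * u^k))) := by
    refine tendsto_tsum_of_dominated_convergence
      (bound := fun k => ‖(tc h k : ℂ) * u^k‖ * ((EE h)⁻¹ * (EE h)⁻¹)) ?_ ?_ ?_
    · exact (JJ_summ hh hu).norm.mul_right _
    · intro k
      have h1 : Tendsto (fun n : ℕ => ac h n k) atTop (𝓝 (tc h k * (EE h * (EE h)⁻¹ * (EE h)⁻¹))) := by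
        refine Tendsto.const_mul _ (Tendsto.mul (Tendsto.mul ?_ (iv_tendsto hh k)) ?_)
        · exact (pp_tendsto hh).comp (tendsto_id.const_mul_atTop' (by norm_num))
        · exact iv_tendsto hh (-k)
      have h2 := ((Complex.continuous_ofReal.tendsto _).comp h1).mul_const (u^k)
      rw [mul_inv_cancel₀ (EE_pos hh).ne', one_mul] at h2
      have e : ((tc h k * (EE h)⁻¹ : ℝ):ℂ) * u^k = ((EE h)⁻¹ : ℝ) * ((tc h k : ℂ) * u^k) := by
        push_cast; ring
      rw [e] at h2
      exact h2
    · refine Eventually.of_forall (fun n k => ?_)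
      have : (ac h n k : ℂ) * u^k = ((tc h k : ℂ) * u^k) * ((pp h (2*n) * iv h (n+k) * iv h (n-k) : ℝ):ℂ) := by
        rw [ac]; push_cast; ring
      rw [this, norm_mul]
      refine mul_le_mul_of_nonneg_left ?_ (norm_nonneg _)
      have a1 := iv_nonneg hh (n+k)
      have a2 := iv_nonneg hh (n-k)
      have a3 := pp_pos hh (2*n)
      rw [Complex.norm_real, Real.norm_of_nonneg (by positivity)]
      have b1 := iv_le hh (n+k)
      have b2 := iv_le hh (n-k)
      have b3 : pp h (2*n) ≤ 1 := by simpa [pp] using pp_anti hh (Nat.zero_le (2*n))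
      calc _ ≤ 1 * (EE h)⁻¹ * (EE h)⁻¹ := by
            have := (EE_pos hh).le
            gcongr
        _ = _ := by ring
  rw [tsum_mul_left] at key
  exact key.congr (fun n => (fin_triple hh hu n).tsum_eq)

lemma EE_hasProd {h : ℝ} (hh : 0 < h) :
    Multipliable (fun i : ℕ => (1 - (Real.exp (-h * (i+1)) : ℂ))) ∧
    ∏' i : ℕ, (1 - (Real.exp (-h * (i+1)) : ℂ)) = EE h := by
  have := (mult_fac hh).hasProd.map Complex.ofRealHom.toMonoidHom Complex.continuous_ofReal
  have h2 : HasProd (fun i : ℕ => (1 - (Real.exp (-h * (i+1)) : ℂ))) (EE h : ℂ) := by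
    convert this using 2 with i
    · simp
    · simp [EE]
  exact ⟨h2.multipliable, h2.tprod_eq⟩

lemma mult_u {h : ℝ} (hh : 0 < h) (u : ℂ) :
    Multipliable (fun i : ℕ => (1 - u * (Real.exp (-h * (i+1)) : ℂ))) := by
  have h1 : Summable (fun i : ℕ => ‖- (u * (Real.exp (-h * (i+1)) : ℂ))‖) := by
    refine ((summ_fac hh).mul_left ‖u‖).congr (fun i => ?_)
    rw [norm_neg, norm_mul, Complex.norm_real, Real.norm_of_nonneg (Real.exp_pos _).le]
  simpa [sub_eq_add_neg] using multipliable_one_add_of_summable h1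

lemma triple {h : ℝ} (hh : 0 < h) {u : ℂ} (hu : u ≠ 0) :
    JJ h u = EE h * ((1 - u) * (∏' i : ℕ, (1 - u * (Real.exp (-h * (i+1)) : ℂ))) *
      ∏' i : ℕ, (1 - u⁻¹ * (Real.exp (-h * (i+1)) : ℂ))) := by
  have h1 := (triple_lim hh hu).comp (tendsto_add_atTop_nat 1)
  have h2 := ((mult_u hh u).hasProd.tendsto_prod_nat).const_mul (1-u)
  have h3 := (mult_u hh u⁻¹).hasProd.tendsto_prod_nat.comp (tendsto_add_atTop_nat 1)
  have h4 := h2.mul h3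
  have := tendsto_nhds_unique h1 (h4.congr (fun n => ?_))
  · rw [← this]
    have := (EE_pos hh).ne'
    push_cast
    rw [mul_inv_cancel_left₀ (by exact_mod_cast this)]
  · simp only [Function.comp]
    rw [Finset.prod_mul_distrib]
    congr 1
    rw [Finset.prod_range_succ']
    simp [mul_comm]



lemma regroup {N : ℕ} (hN : 0 < N) (g : ℕ → ℂ) (hg : Multipliable g)
    (hk : ∀ k : Fin N, Multipliable (fun n : ℕ => g (N*n+k))) :
    ∏ k : Fin N, ∏' n : ℕ, g (N*n+k) = ∏' m, g m := by
  have h1 : Tendsto (fun n => ∏ k : Fin N, ∏ i ∈ Finset.range n, g (N*i+k)) atTop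
      (𝓝 (∏ k : Fin N, ∏' n : ℕ, g (N*n+k))) :=
    tendsto_finsetProd _ (fun k _ => (hk k).hasProd.tendsto_prod_nat)
  have h2 : Tendsto (fun n : ℕ => N*n) atTop atTop := tendsto_id.const_mul_atTop' hN
  have h3 := hg.hasProd.tendsto_prod_nat.comp h2
  refine tendsto_nhds_unique h1 (h3.congr (fun n => ?_))
  simp only [Function.comp]
  rw [Finset.prod_comm]
  induction n with
  | zero => simp
  | succ n ih =>
    rw [Finset.prod_range_succ, ← ih, mul_add, mul_one, Finset.prod_range_add,
      ← Fin.prod_univ_eq_prod_range (fun x => g (N*n+x))]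

noncomputable def TT (h : ℝ) (u : ℂ) : ℂ := ∏' i : ℕ, (1 - u * (Real.exp (-h * (i+1)) : ℂ))

lemma TT_one {h : ℝ} (hh : 0 < h) : TT h 1 = EE h := by
  simpa [TT] using (EE_hasProd hh).2

lemma triple' {h : ℝ} (hh : 0 < h) {u : ℂ} (hu : u ≠ 0) :
    JJ h u = EE h * ((1 - u) * TT h u * TT h u⁻¹) := triple hh hu

lemma TT_zero {h : ℝ} (hh : 0 < h) (u : ℂ) :
    Multipliable (fun i : ℕ => (1 - u * (Real.exp (-h * i) : ℂ))) ∧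
    ∏' i : ℕ, (1 - u * (Real.exp (-h * i) : ℂ)) = (1-u) * TT h u := by
  have h1 : Multipliable (fun i : ℕ => (1 - u * (Real.exp (-h * i) : ℂ))) := by
    refine (mult_u hh (u * Real.exp h)).congr (fun i => ?_)
    rw [mul_assoc, ← Complex.ofReal_mul, ← Real.exp_add]
    congr 4; ring
  refine ⟨h1, ?_⟩
  have h2 := ((mult_u hh u).hasProd.tendsto_prod_nat).const_mul (1-u)
  have h3 := h1.hasProd.tendsto_prod_nat.comp (tendsto_add_atTop_nat 1)
  refine tendsto_nhds_unique h3 (h2.congr (fun n => ?_))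
  simp only [Function.comp]
  rw [Finset.prod_range_succ']
  simp [mul_comm]

lemma E1 {N : ℕ} (hN : 0 < N) {h : ℝ} (hh : 0 < h) :
    (∏ k : Fin N, JJ (N*h) (-(Real.exp (-h*(k:ℕ)) : ℂ))) * EE h = EE (N*h)^N * JJ h (-1) := by
  have hNh : 0 < N*h := by positivity
  have e (k : Fin N) : JJ (N*h) (-(Real.exp (-h*(k:ℕ)) : ℂ)) = EE (N*h) *
      ((∏' n : ℕ, (1 - (-1) * (Real.exp (-h * ((N*n+(k:ℕ) : ℕ):ℝ)) : ℂ))) *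
       (∏' n : ℕ, (1 - (-1) * (Real.exp (-h * ((N*n+(Fin.rev k : Fin N) : ℕ)+1)) : ℂ)))) := by
    have hne : -(Real.exp (-h*(k:ℕ)) : ℂ) ≠ 0 := by
      rw [neg_ne_zero]; exact_mod_cast (Real.exp_pos _).ne'
    rw [triple' hNh hne, ← (TT_zero hNh _).2, TT]
    congr 2
    · refine tprod_congr (fun n => ?_)
      rw [neg_one_mul, neg_mul (Real.exp (-h*(k:ℕ)) : ℂ), ← Complex.ofReal_mul, ← Real.exp_add]
      congr 4; push_cast; ring
    · refine tprod_congr (fun n => ?_)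
      rw [inv_neg, ← Complex.ofReal_inv, ← Real.exp_neg, neg_one_mul, neg_mul (Real.exp _ : ℂ),
        ← Complex.ofReal_mul, ← Real.exp_add]
      congr 4
      have : ((Fin.rev k : Fin N) : ℕ) + (k:ℕ) + 1 = N := by
        rw [Fin.val_rev]; omega
      have : (((Fin.rev k : Fin N) : ℕ):ℝ) + ((k:ℕ):ℝ) + 1 = N := by exact_mod_cast this
      push_cast
      linear_combination h * this
  simp_rw [e]
  rw [Finset.prod_mul_distrib, Finset.prod_mul_distrib]
  have m (c : ℝ) : Multipliable (fun n : ℕ => (1 - (-1) * (Real.exp (-h * (n + c)) : ℂ))) := by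
    refine (TT_zero hh ((-1) * Real.exp (-h*c))).1.congr (fun i => ?_)
    rw [mul_assoc, ← Complex.ofReal_mul, ← Real.exp_add]
    congr 4; ring
  have m2 (c : ℝ) : Multipliable (fun n : ℕ => (1 - (-1) * (Real.exp (-(N*h) * n + c) : ℂ))) := by
    refine (TT_zero hNh ((-1) * Real.exp (c))).1.congr (fun i => ?_)
    rw [mul_assoc, ← Complex.ofReal_mul, ← Real.exp_add]
    congr 4; ring
  rw [regroup hN (fun m => 1 - (-1) * (Real.exp (-h * (m:ℝ)) : ℂ)) (by simpa using m 0)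
    (fun k => (m2 (-h*(k:ℕ))).congr (fun i => by congr 4; push_cast; ring))]
  have r2 := regroup hN (fun m => 1 - (-1) * (Real.exp (-h * (m+1)) : ℂ)) (by simpa using m 1)
    (fun k => (m2 (-h*((k:ℕ)+1))).congr (fun i => by congr 4; push_cast; ring))
  rw [← Equiv.prod_comp Fin.revPerm] at r2
  simp only [Fin.revPerm_apply] at r2
  rw [r2, triple' hh (by norm_num : (-1:ℂ) ≠ 0), (TT_zero hh (-1)).2]
  have : (-1:ℂ)⁻¹ = -1 := by norm_num
  rw [this]
  simp only [TT, Finset.prod_const, Finset.card_univ, Fintype.card_fin]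
  ring

noncomputable def uu (N : ℕ) (j k : Fin N) : ℂ := cexp (2*Real.pi*I*((j:ℕ)/N - (k:ℕ)/N))

lemma uu_ne {N : ℕ} (j k : Fin N) (hjk : j ≠ k) : uu N j k ≠ 1 := by
  have hN : 0 < N := j.pos
  have hz := Complex.isPrimitiveRoot_exp N hN.ne'
  intro h
  apply hjk
  have h2 : cexp (2*Real.pi*I/N)^(j:ℕ) = cexp (2*Real.pi*I/N)^(k:ℕ) := by
    rw [← Complex.exp_nat_mul, ← Complex.exp_nat_mul]
    have : cexp ((j:ℕ) * (2*Real.pi*I/N)) = uu N j k * cexp ((k:ℕ) * (2*Real.pi*I/N)) := by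
      rw [uu, ← Complex.exp_add]; congr 1; ring
    rw [this, h, one_mul]
  exact Fin.ext (hz.pow_inj j.2 k.2 h2)

lemma uu_prod {N : ℕ} (j : Fin N) (X : ℂ) : ∏ k, (1 - uu N j k * X) = 1 - X^N := by
  have hN : 0 < N := j.pos
  have hz := Complex.isPrimitiveRoot_exp N hN.ne'
  have := hz.pow_sub_pow_eq_prod_sub_mul (1:ℂ) X hN
  rw [one_pow] at this
  rw [this]
  have hinj : Function.Injective (uu N j) := by
    intro k k' h
    by_contra hne
    apply uu_ne k k' hne
    have e : uu N k k' = uu N j k' * (uu N j k)⁻¹ := by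
      simp only [uu]; rw [← Complex.exp_neg, ← Complex.exp_add]; congr 1; ring
    rw [e, h, mul_inv_cancel₀ (by rw [uu]; exact Complex.exp_ne_zero _)]
  have him : Finset.univ.image (uu N j) = Polynomial.nthRootsFinset N (1:ℂ) := by
    apply Finset.eq_of_subset_of_card_le
    · intro z hz
      obtain ⟨k, -, rfl⟩ := Finset.mem_image.1 hz
      rw [Polynomial.mem_nthRootsFinset hN, uu, ← Complex.exp_nat_mul]
      rw [Complex.exp_eq_one_iff]
      refine ⟨(j:ℤ) - (k:ℤ), ?_⟩
      have : (N:ℂ) ≠ 0 := by exact_mod_cast hN.ne'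
      push_cast
      field_simp
    · rw [Finset.card_image_of_injective _ hinj, hz.card_nthRootsFinset]; simp
  rw [← him, Finset.prod_image (fun a _ b _ h => hinj h)]

lemma pairs_card (N : ℕ) : ∑ j : Fin N, (Finset.Ioi j).card = N*(N-1)/2 := by
  simp only [Fin.card_Ioi]
  rw [Fin.sum_univ_eq_sum_range (fun j => N - 1 - j) N, Finset.sum_range_reflect (fun j => j),
    Finset.sum_range_id]

lemma E2 (N : ℕ) (hN : 0 < N) : ∃ K : ℂ, K ≠ 0 ∧ ∀ h : ℝ, 0 < h →
    (∏ j : Fin N, ∏ k ∈ Finset.Ioi j, JJ h (uu N j k)) * EE h ^ N =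
      K * EE h ^ (N*(N-1)/2) * EE (N*h)^N := by
  refine ⟨∏ j : Fin N, ∏ k ∈ Finset.Ioi j, (1 - uu N j k), ?_, fun h hh => ?_⟩
  · refine Finset.prod_ne_zero_iff.2 (fun j _ => Finset.prod_ne_zero_iff.2 (fun k hk => ?_))
    rw [sub_ne_zero]
    exact (uu_ne j k (Finset.mem_Ioi.1 hk).ne).symm
  have inv (j k : Fin N) : (uu N j k)⁻¹ = uu N k j := by
    rw [uu, uu, ← Complex.exp_neg]; congr 1; ring
  have e1 : ∀ j k : Fin N, JJ h (uu N j k) = EE h * ((1 - uu N j k) * (TT h (uu N j k) * TT h (uu N k j))) := by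
    intro j k
    rw [triple' hh (by rw [uu]; exact Complex.exp_ne_zero _), inv]; ring
  simp_rw [e1, Finset.prod_mul_distrib]
  have e2 : (∏ j : Fin N, ∏ k ∈ Finset.Ioi j, (EE h : ℂ)) = EE h ^ (N*(N-1)/2) := by
    simp only [Finset.prod_const]
    rw [Finset.prod_pow_eq_pow_sum, pairs_card]
  have e3 := Finset.prod_prod_Ioi_mul_eq_prod_prod_off_diag (fun j k : Fin N => TT h (uu N k j))
  simp_rw [Finset.prod_mul_distrib] at e3
  have e4 : (∏ j : Fin N, ∏ k ∈ {j}ᶜ, TT h (uu N j k)) * EE h ^ N = EE (N*h)^N := by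
    have : (EE h : ℂ)^N = ∏ j : Fin N, TT h (uu N j j) := by
      simp [uu, TT_one hh]
    rw [this, ← Finset.prod_mul_distrib]
    have e5 : ∀ j : Fin N, (∏ k ∈ {j}ᶜ, TT h (uu N j k)) * TT h (uu N j j) = EE (N*h) := by
      intro j
      rw [mul_comm, ← Fintype.prod_eq_mul_prod_compl j (fun k => TT h (uu N j k))]
      simp only [TT]
      rw [← Multipliable.tprod_finsetProd (fun k _ => mult_u hh _), ← (EE_hasProd (by positivity : 0 < N*h)).2]
      refine tprod_congr (fun n => ?_)
      rw [uu_prod]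
      rw [← Complex.ofReal_pow, ← Real.exp_nat_mul]
      congr 3; ring
    simp_rw [e5]
    simp
  rw [e2, ← e4, ← e3]
  ring


lemma pi_ne : (Real.pi:ℂ) ≠ 0 := by exact_mod_cast Real.pi_ne_zero

noncomputable def th (h : ℝ) (v : ℂ) : ℂ := theta1 v (I * h / (2 * Real.pi))

noncomputable def tht (h : ℝ) (v : ℂ) (n : ℤ) : ℂ :=
  I * cexp (Real.pi * I * n - h/2*(n-1/2)^2 + Real.pi * I * (2*n-1)*v)

lemma neg_one_zpow_exp (n : ℤ) : ((-1:ℂ))^n = cexp (Real.pi * I * n) := by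
  rw [mul_comm, Complex.exp_int_mul, Complex.exp_pi_mul_I]

lemma th_hasSum {h : ℝ} (hh : 0 < h) (v : ℂ) : HasSum (tht h v) (th h v) := by
  have hs : Summable (fun n : ℤ => cexp (Real.pi * I * n - h/2*(n-1/2)^2 + Real.pi * I * (2*n-1)*v)) := by
    refine (summ_quad ((-h/2 : ℝ):ℂ) (Real.pi * I + h/2 + 2 * Real.pi * I * v) (-h/8 - Real.pi * I * v)
      (by rw [Complex.ofReal_re]; linarith)).congr (fun n => ?_)
    congr 1; push_cast; ring
  refine hs_congr (hs.hasSum.mul_left I) (fun n => rfl) ?_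
  rw [th, theta1]
  congr 1
  refine tsum_congr (fun n => ?_)
  rw [neg_one_zpow_exp, ← Complex.exp_add, ← Complex.exp_add]
  congr 1
  have := pi_ne
  have h2 : Real.pi * I * (I * h / (2 * Real.pi)) = -(h/2:ℂ) := by
    field_simp; simp
  rw [h2]; ring

lemma th_neg {h : ℝ} (hh : 0 < h) (v : ℂ) : th h (-v) = - th h v := by
  have h1 := (Equiv.subLeft (1:ℤ)).hasSum_iff.2 (th_hasSum hh v)
  refine (th_hasSum hh (-v)).unique (hs_congr h1.neg (fun n => ?_) rfl)
  simp only [Function.comp, Equiv.subLeft_apply, tht]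
  have : cexp (Real.pi * I * n - h/2*(n-1/2)^2 + Real.pi * I * (2*n-1)*(-v)) =
    cexp (Real.pi * I * ((1-n:ℤ):ℂ) - h/2*(((1-n:ℤ):ℂ)-1/2)^2 + Real.pi * I * (2*((1-n:ℤ):ℂ)-1)*v)
      * cexp (Real.pi * I) * cexp ((n-1:ℤ)*(2*Real.pi*I)) := by
    rw [← Complex.exp_add, ← Complex.exp_add]; congr 1; push_cast; ring
  rw [this, Complex.exp_pi_mul_I, Complex.exp_int_mul_two_pi_mul_I]
  ring

lemma th_JJ {h : ℝ} (hh : 0 < h) (v : ℂ) :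
    th h v = cexp (-h/8) * (I * cexp (-Real.pi * I * v)) * JJ h (cexp (2*Real.pi*I*v)) := by
  refine (th_hasSum hh v).unique (hs_congr
    ((JJ_summ hh (Complex.exp_ne_zero (2*Real.pi*I*v))).hasSum.mul_left _) (fun n => ?_) rfl)
  rw [tht, tc, ← Complex.exp_int_mul]
  push_cast
  rw [neg_one_zpow_exp]
  have : cexp (-h/8) * (I * cexp (-Real.pi * I * v)) * (cexp (Real.pi * I * n) * cexp (-h * (n*(n-1)/2)) *
     cexp (n * (2*Real.pi*I*v))) = I * (cexp (-h/8) * cexp (-Real.pi * I * v) * (cexp (Real.pi * I * n)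
      * cexp (-h * (n*(n-1)/2)) * cexp (n * (2*Real.pi*I*v)))) := by ring
  rw [this]
  simp only [← Complex.exp_add]
  congr 2; ring

def QQ (h : ℝ) (N : ℕ) (κ : ℂ) (f : ℂ → ℂ) : Prop :=
  ∃ c : ℤ → ℂ, (∀ x, HasSum (fun M : ℤ => c M * cexp (Real.pi * I * (2*M-N) * x)) (f x)) ∧
    ∀ M : ℤ, c (M+N) = κ * cexp (-h*M) * c M

def shearEq : ℤ × ℤ ≃ ℤ × ℤ where
  toFun p := (p.1 - p.2, p.2)
  invFun p := (p.1 + p.2, p.2)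
  left_inv p := by simp
  right_inv p := by simp

lemma mulHS {F G : ℤ → ℂ} {a b : ℂ} (hF : HasSum F a) (hG : HasSum G b) :
    HasSum (fun p : ℤ × ℤ => F p.1 * G p.2) (a * b) := by
  have h1 : Summable (fun p : ℤ × ℤ => F p.1 * G p.2) :=
    summable_mul_of_summable_norm (f := F) (g := G) hF.summable.norm hG.summable.norm
  exact hF.mul hG h1

lemma QQ_mul {h : ℝ} {N N' : ℕ} {κ κ' : ℂ} {f g : ℂ → ℂ} (hf : QQ h N κ f) (hg : QQ h N' κ' g) :
    QQ h (N+N') (κ*κ') (fun x => f x * g x) := by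
  obtain ⟨c, hc, hc'⟩ := hf
  obtain ⟨b, hb, hb'⟩ := hg
  have pair (x : ℂ) : HasSum (fun p : ℤ × ℤ => (c (p.1-p.2) * b p.2) *
      cexp (Real.pi * I * (2*p.1-(N+N':ℕ)) * x)) (f x * g x) := by
    have h1 := mulHS (hc x) (hb x)
    refine hs_congr (shearEq.hasSum_iff.2 h1) (fun p => ?_) rfl
    simp only [Function.comp, shearEq, Equiv.coe_fn_mk]
    have : cexp (Real.pi * I * (2*p.1-(N+N':ℕ)) * x) = cexp (Real.pi * I * (2*((p.1-p.2:ℤ):ℂ)-N) * x)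
        * cexp (Real.pi * I * (2*p.2-N') * x) := by
      rw [← Complex.exp_add]; congr 1; push_cast; ring
    rw [this]; ring
  have fib (M : ℤ) : HasSum (fun l => c (M-l) * b l) (∑' l, c (M-l) * b l) := by
    have := (pair 0).summable.prod_factor M
    simpa using this.hasSum
  refine ⟨fun M => ∑' l, c (M-l) * b l, fun x => ?_, fun M => ?_⟩
  · exact (pair x).prod_fiberwise (fun M => (fib M).mul_right _)
  · show ∑' l, c (M+(N+N':ℕ)-l) * b l = _ * ∑' l, c (M-l) * b l
    rw [← tsum_mul_left, ← (Equiv.addRight (N':ℤ)).tsum_eq]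
    refine tsum_congr (fun l => ?_)
    simp only [Equiv.coe_addRight]
    have e : M + (N+N':ℕ) - (l + N') = (M - l) + N := by push_cast; ring
    rw [e, hc', hb']
    have : cexp (-h*M) = cexp (-h*(M-l:ℤ)) * cexp (-h*l) := by
      rw [← Complex.exp_add]; congr 1; push_cast; ring
    rw [this]; ring

lemma QQ_smul {h : ℝ} {N : ℕ} {κ : ℂ} {f : ℂ → ℂ} (hf : QQ h N κ f) (a : ℂ) :
    QQ h N κ (fun x => f x * a) := by
  obtain ⟨c, hc, hc'⟩ := hf
  refine ⟨fun M => c M * a, fun x => hs_congr ((hc x).mul_right a) (fun M => by ring) rfl, fun M => ?_⟩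
  simp only [hc']; ring

lemma QQ_th {h : ℝ} (hh : 0 < h) (a : ℂ) :
    QQ h 1 (-cexp (2*Real.pi*I*a)) (fun x => th h (x+a)) := by
  refine ⟨tht h a, fun x => hs_congr (th_hasSum hh (x+a)) (fun n => ?_) rfl, fun n => ?_⟩
  · rw [tht, tht, mul_assoc, ← Complex.exp_add]
    congr 2; push_cast; ring
  · rw [tht, tht]
    have : cexp (Real.pi * I * (n+(1:ℕ):ℤ) - h/2*((n+(1:ℕ):ℤ)-1/2)^2 + Real.pi * I * (2*(n+(1:ℕ):ℤ)-1)*a) =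
       cexp (Real.pi * I) * (cexp (2*Real.pi*I*a) * cexp (-h*n) *
        cexp (Real.pi * I * n - h/2*(n-1/2)^2 + Real.pi * I * (2*n-1)*a)) := by
      simp only [← Complex.exp_add]; congr 1; push_cast; ring
    rw [this, Complex.exp_pi_mul_I]; ring

lemma QQ_prod {h : ℝ} (hh : 0 < h) (a : ℂ) {ι : Type*} [DecidableEq ι] (s : Finset ι) (z : ι → ℂ) :
    QQ h (s.card+1) (-cexp (2*Real.pi*I*a) * ∏ k ∈ s, (-cexp (2*Real.pi*I*(-z k))))
      (fun x => th h (x+a) * ∏ k ∈ s, th h (x - z k)) := by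
  induction s using Finset.induction_on with
  | empty => simpa using QQ_th hh a
  | insert i s hi ih =>
    have := QQ_mul ih (QQ_th hh (-z i))
    rw [Finset.card_insert_of_notMem hi]
    simp only [Finset.prod_insert hi]
    convert this using 1
    · ring
    · funext x; rw [sub_eq_add_neg x (z i)]; ring

noncomputable def ffe (N : ℕ) (e : ℤ) (h : ℝ) (k : Fin N) (x : ℂ) (l : ℤ) : ℂ :=
  Real.pi * I * e * l - h*((k:ℕ)+N*l-N/2)^2/(2*N) + 2*Real.pi*I*((k:ℕ)+N*l-N/2)*x

noncomputable def ff (N : ℕ) (e : ℤ) (h : ℝ) (k : Fin N) (x : ℂ) : ℂ :=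
  ∑' l : ℤ, cexp (ffe N e h k x l)

lemma ff_summ {N : ℕ} (e : ℤ) {h : ℝ} (hh : 0 < h) (k : Fin N) (x : ℂ) :
    Summable (fun l => cexp (ffe N e h k x l)) := by
  have hN : 0 < N := k.pos
  have hN' : (N:ℂ) ≠ 0 := by exact_mod_cast hN.ne'
  refine (summ_quad ((-h*N/2 : ℝ):ℂ) (Real.pi*I*e - h*((k:ℕ)-N/2) + 2*Real.pi*I*N*x)
      (-h*((k:ℕ)-N/2)^2/(2*N) + 2*Real.pi*I*((k:ℕ)-N/2)*x)
      (by rw [Complex.ofReal_re]; have : 0 < h*N := by positivity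
          linarith)).congr (fun n => ?_)
  congr 1; rw [ffe]; push_cast; field_simp; ring

lemma QQ_coef {h : ℝ} {N : ℕ} {e : ℤ} {c : ℤ → ℂ} (hc : ∀ M : ℤ, c (M+N) = cexp (Real.pi*I*e) * cexp (-h*M) * c M)
    (k : Fin N) (l : ℤ) : c (l*N + (k:ℕ)) = cexp (ffe N e h k 0 l) * (c (k:ℕ) * cexp (-ffe N e h k 0 0)) := by
  have hN : 0 < N := k.pos
  have hN' : (N:ℂ) ≠ 0 := by exact_mod_cast hN.ne'
  have step (l : ℤ) : c ((l+1)*N + (k:ℕ)) * cexp (-ffe N e h k 0 (l+1)) = c (l*N + (k:ℕ)) * cexp (-ffe N e h k 0 l) := by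
    have e1 : (l+1)*(N:ℤ) + (k:ℕ) = (l*N+(k:ℕ)) + N := by ring
    rw [e1, hc]
    have : cexp (Real.pi*I*e) * cexp (-h*(l*N+(k:ℕ):ℤ)) * cexp (-ffe N e h k 0 (l+1)) = cexp (-ffe N e h k 0 l) := by
      simp only [← Complex.exp_add]
      congr 1
      simp only [ffe]; push_cast; field_simp; ring
    rw [← this]; ring
  have all (l : ℤ) : c (l*N + (k:ℕ)) * cexp (-ffe N e h k 0 l) = c (k:ℕ) * cexp (-ffe N e h k 0 0) := by
    induction l using Int.induction_on with
    | zero => simp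
    | succ i ih => rw [step, ih]
    | pred i ih => rw [← ih, ← step]; congr 2 <;> ring_nf
  rw [← all l, mul_left_comm, ← Complex.exp_add]; simp

lemma QQ_span {h : ℝ} (hh : 0 < h) {N : ℕ} (hN : 0 < N) {e : ℤ} {f : ℂ → ℂ} (hf : QQ h N (cexp (Real.pi*I*e)) f) :
    ∃ a : Fin N → ℂ, ∀ x, f x = ∑ k, a k * ff N e h k x := by
  obtain ⟨c, hc, hc'⟩ := hf
  have : NeZero N := ⟨hN.ne'⟩
  refine ⟨fun k => c (k:ℕ) * cexp (-ffe N e h k 0 0), fun x => ?_⟩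
  have h1 := ((Equiv.prodComm (Fin N) ℤ).trans (Int.divModEquiv N).symm).hasSum_iff.2 (hc x)
  have h2 := h1.prod_fiberwise (g := fun k : Fin N => (c (k:ℕ) * cexp (-ffe N e h k 0 0)) * ff N e h k x) (fun k => ?_)
  · exact h2.unique (hasSum_fintype _)
  · refine hs_congr ((ff_summ e hh k x).hasSum.mul_left _) (fun l => ?_) rfl
    simp only [Function.comp, Equiv.trans_apply, Equiv.prodComm_apply, Prod.swap, Int.divModEquiv_symm_apply]
    rw [QQ_coef hc']
    have : cexp (ffe N e h k x l) = cexp (ffe N e h k 0 l) * cexp (Real.pi * I * (2*((l*N+(k:ℕ):ℤ):ℂ)-N)*x) := by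
      rw [← Complex.exp_add]; congr 1; simp only [ffe]; push_cast; ring
    rw [this]; ring


noncomputable def Th {N : ℕ} (h : ℝ) (d : ℂ) (x : Fin N → ℂ) : ℂ :=
  th h (d + ∑ j, x j) * ∏ j : Fin N, ∏ k ∈ Finset.Ioi j, th h (x j - x k)

noncomputable def Dt {N : ℕ} (e : ℤ) (h : ℝ) (x : Fin N → ℂ) : ℂ :=
  (Matrix.of fun j k => ff N e h k (x j)).det

lemma Th_perm {N : ℕ} {h : ℝ} (hh : 0 < h) (d : ℂ) (x : Fin N → ℂ) (σ : Equiv.Perm (Fin N)) :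
    Th h d (x ∘ σ) = ((Equiv.Perm.sign σ : ℤ) : ℂ) * Th h d x := by
  rw [Th, Th]
  have h1 := Equiv.Perm.prod_Ioi_comp_eq_sign_mul_prod σ (f := fun i j => th h (x i - x j))
    (fun i j => by rw [← th_neg hh, neg_sub])
  simp only [Function.comp]
  rw [h1, Equiv.sum_comp σ x]; ring

lemma Dt_perm {N : ℕ} (e : ℤ) (h : ℝ) (x : Fin N → ℂ) (σ : Equiv.Perm (Fin N)) :
    Dt e h (x ∘ σ) = ((Equiv.Perm.sign σ : ℤ) : ℂ) * Dt e h x := by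
  rw [Dt, Dt, ← Matrix.det_permute]
  rfl

lemma Dt_span {N : ℕ} (e : ℤ) (h : ℝ) (x : Fin N → ℂ) (i : Fin N) :
    ∃ a : Fin N → ℂ, ∀ y, Dt e h (Function.update x i y) = ∑ k, a k * ff N e h k y := by
  have key : ∀ y, Dt e h (Function.update x i y) =
      ((Matrix.of fun j k => ff N e h k (x j)).updateRow i (fun k => ff N e h k y)).det := by
    intro y
    rw [Dt]
    congr 1
    ext j k
    by_cases hj : j = i
    · subst hj; simp
    · simp [hj]
  refine ⟨fun k => ((Matrix.of fun j k => ff N e h k (x j)).updateRow i (Pi.single k 1)).det, fun y => ?_⟩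
  rw [key]
  set M := (Matrix.of fun j k => ff N e h k (x j))
  have : (fun k => ff N e h k y) = ∑ k, ff N e h k y • (Pi.single k 1 : Fin N → ℂ) := by
    ext j; simp [Finset.sum_apply, Pi.single_apply]
  rw [this]
  have h3 := map_sum (Matrix.detRowAlternating.toMultilinearMap.toLinearMap M i)
    (fun k => ff N e h k y • (Pi.single k 1 : Fin N → ℂ)) Finset.univ
  have h4 : ∀ v, (Matrix.detRowAlternating.toMultilinearMap.toLinearMap M i) v = (M.updateRow i v).det := fun v => rfl
  simp only [h4] at h3
  rw [h3]
  refine Finset.sum_congr rfl (fun k _ => ?_)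
  rw [Matrix.det_updateRow_smul, mul_comm]

lemma Th_span0 {n : ℕ} {h : ℝ} (hh : 0 < h) (m : ℤ) (x : Fin (n+1) → ℂ) :
    ∃ a : Fin (n+1) → ℂ, ∀ y, Th h (m/2) (Function.update x 0 y) =
      ∑ k, a k * ff (n+1) ((n+1:ℕ)+m) h k y := by
  have h1 := QQ_smul (QQ_prod hh (m/2 + ∑ j : Fin n, x j.succ) Finset.univ (fun j : Fin n => x j.succ))
    (∏ j : Fin n, ∏ k ∈ Finset.Ioi j, th h (x j.succ - x k.succ))
  have hκ : (-cexp (2*Real.pi*I*(m/2 + ∑ j : Fin n, x j.succ)) *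
      ∏ k : Fin n, (-cexp (2*Real.pi*I*(-x k.succ)))) = cexp (Real.pi * I * (((n+1:ℕ)+m : ℤ):ℂ)) := by
    have e1 : ∀ k : Fin n, -cexp (2*Real.pi*I*(-x k.succ)) = cexp (Real.pi * I + 2*Real.pi*I*(-x k.succ)) := by
      intro k; rw [Complex.exp_add, Complex.exp_pi_mul_I]; ring
    simp_rw [e1]
    rw [← Complex.exp_sum, neg_mul, ← Complex.exp_add, Finset.sum_add_distrib,
      ← Finset.mul_sum Finset.univ (fun k : Fin n => -x k.succ), Finset.sum_neg_distrib]
    have : ∀ z, -cexp z = cexp (Real.pi * I + z) := by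
      intro z; rw [Complex.exp_add, Complex.exp_pi_mul_I]; ring
    rw [this]
    congr 1
    simp only [Finset.sum_const, Finset.card_univ, Fintype.card_fin, nsmul_eq_mul]
    push_cast
    ring
  rw [hκ, Finset.card_univ, Fintype.card_fin] at h1
  obtain ⟨a, ha⟩ := QQ_span hh (Nat.succ_pos n) h1
  refine ⟨a, fun y => ?_⟩
  rw [← ha y, Th, Fin.prod_univ_succ, Fin.sum_univ_succ, Fin.prod_Ioi_zero]
  simp only [Fin.prod_Ioi_succ, Function.update_self, Function.update_of_ne (Fin.succ_ne_zero _)]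
  rw [← mul_assoc]
  congr 3
  ring

lemma Th_span {N : ℕ} {h : ℝ} (hh : 0 < h) (m : ℤ) (x : Fin N → ℂ) (i : Fin N) :
    ∃ a : Fin N → ℂ, ∀ y, Th h (m/2) (Function.update x i y) =
      ∑ k, a k * ff N (N+m) h k y := by
  obtain ⟨n, rfl⟩ : ∃ n, N = n+1 := ⟨N-1, by have := i.pos; omega⟩
  obtain ⟨a, ha⟩ := Th_span0 hh m (x ∘ Equiv.swap 0 i)
  refine ⟨fun k => ((Equiv.Perm.sign (Equiv.swap 0 i) : ℤ) : ℂ) * a k, fun y => ?_⟩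
  simp_rw [mul_assoc]
  rw [← Finset.mul_sum, ← ha, ← Th_perm hh]
  congr 1
  ext j
  simp only [Function.comp, Function.update_apply]
  have : Equiv.swap 0 i j = 0 ↔ j = i := by
    rw [Equiv.swap_apply_eq_iff, Equiv.swap_apply_left]
  simp [this]

lemma grid_zero {N : ℕ} (f : Fin N → ℂ → ℂ) (P : Fin N → ℂ)
    (hP : (Matrix.of fun j k => f k (P j)).det ≠ 0) (T : (Fin N → ℂ) → ℂ)
    (hspan : ∀ x i, ∃ a : Fin N → ℂ, ∀ y, T (Function.update x i y) = ∑ k, a k * f k y)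
    (hperm : ∀ x (σ : Equiv.Perm (Fin N)), T (x ∘ σ) = ((Equiv.Perm.sign σ : ℤ) : ℂ) * T x)
    (h0 : T P = 0) (x : Fin N → ℂ) : T x = 0 := by
  have grid : ∀ φ : Fin N → Fin N, T (P ∘ φ) = 0 := by
    intro φ
    by_cases hφ : Function.Injective φ
    · have := hperm P (Equiv.ofBijective φ (Finite.injective_iff_bijective.1 hφ))
      rw [h0, mul_zero] at this
      exact this
    · rw [Function.Injective] at hφ
      push Not at hφ
      obtain ⟨i, j, hij, hne⟩ := hφ
      have := hperm (P ∘ φ) (Equiv.swap i j)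
      rw [Equiv.Perm.sign_swap hne] at this
      have e : (P ∘ φ) ∘ (Equiv.swap i j) = P ∘ φ := by
        ext l
        simp only [Function.comp]
        congr 1
        by_cases h1 : l = i
        · subst h1; simp [hij]
        · by_cases h2 : l = j
          · subst h2; simp [hij]
          · rw [Equiv.swap_apply_of_ne_of_ne h1 h2]
      rw [e] at this
      simp at this
      have h2 : T (P ∘ φ) + T (P ∘ φ) = 0 := by linear_combination this
      simpa using h2
  have main : ∀ s : Finset (Fin N), ∀ x : Fin N → ℂ, (∀ i ∉ s, ∃ j, x i = P j) → T x = 0 := by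
    intro s
    induction s using Finset.induction_on with
    | empty =>
      intro x hx
      choose φ hφ using fun i => hx i (Finset.notMem_empty i)
      have : x = P ∘ φ := funext hφ
      rw [this]; exact grid φ
    | insert i s hi ih =>
      intro x hx
      obtain ⟨a, ha⟩ := hspan x i
      have hz : (Matrix.of fun j k => f k (P j)).mulVec a = 0 := by
        ext j
        have h1 := ih (Function.update x i (P j)) (fun l hl => by
          by_cases hli : l = i
          · subst hli; exact ⟨j, by simp⟩
          · rw [Function.update_of_ne hli]
            exact hx l (by simp [hli, hl]))
        rw [ha] at h1
        simp only [Matrix.mulVec, dotProduct, Matrix.of_apply, Pi.zero_apply]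
        rw [← h1]
        exact Finset.sum_congr rfl (fun k _ => mul_comm _ _)
      have ha0 := Matrix.eq_zero_of_mulVec_eq_zero hP hz
      have := ha (x i)
      rw [Function.update_eq_self, ha0] at this
      simpa using this
  exact main Finset.univ x (fun i hi => absurd (Finset.mem_univ i) hi)

lemma Th_Dt {N : ℕ} {h : ℝ} (hh : 0 < h) (m : ℤ) (P : Fin N → ℂ) (hP : Dt (N+m) h P ≠ 0) (x : Fin N → ℂ) :
    Th h (m/2) x * Dt (N+m) h P = Th h (m/2) P * Dt (N+m) h x := by
  have := grid_zero (fun k => ff N (N+m) h k) P hP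
    (fun x => Th h (m/2) x * Dt (N+m) h P - Th h (m/2) P * Dt (N+m) h x) ?_ ?_ ?_ x
  · linear_combination this
  · intro x i
    obtain ⟨a, ha⟩ := Th_span hh m x i
    obtain ⟨b, hb⟩ := Dt_span (N+m) h x i
    refine ⟨fun k => a k * Dt (N+m) h P - Th h (m/2) P * b k, fun y => ?_⟩
    simp only [ha, hb, Finset.sum_mul, Finset.mul_sum]
    rw [← Finset.sum_sub_distrib]
    exact Finset.sum_congr rfl (fun k _ => by ring)
  · intro x σ
    simp only [Th_perm hh, Dt_perm]; ring
  · ring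


lemma tc_neg_exp (H a : ℝ) (l : ℤ) : (tc H l : ℂ) * (-(Real.exp a : ℂ))^l =
    ((Real.exp (-H*(l*(l-1)/2) + a * l) : ℝ) : ℂ) := by
  rw [tc, neg_eq_neg_one_mul (Real.exp a : ℂ), mul_zpow, Real.exp_add]
  have h1 : ((-1:ℂ))^l * (-1)^l = 1 := by rw [← mul_zpow]; simp
  have h2 : (Real.exp a : ℂ)^l = ((Real.exp (a*l) : ℝ):ℂ) := by
    push_cast; rw [← Complex.exp_int_mul]; congr 1; ring
  rw [h2]
  push_cast
  linear_combination (cexp (-H*(l*(l-1)/2)) * cexp (a*l)) * h1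

lemma JJ_neg_ne {H : ℝ} (hH : 0 < H) (a : ℝ) : JJ H (-(Real.exp a : ℂ)) ≠ 0 := by
  have hne : -(Real.exp a : ℂ) ≠ 0 := by
    rw [neg_ne_zero]; exact_mod_cast (Real.exp_pos _).ne'
  have h1 := (JJ_summ hH hne).hasSum
  have h2 : HasSum (fun l : ℤ => ((Real.exp (-H*(l*(l-1)/2) + a * l) : ℝ) : ℂ)) (JJ H (-(Real.exp a : ℂ))) :=
    hs_congr h1 (fun l => (tc_neg_exp H a l).symm) rfl
  have h3 := Complex.hasSum_re h2
  simp only [Complex.ofReal_re] at h3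
  have h4 : 0 < (JJ H (-(Real.exp a : ℂ))).re := by
    rw [← h3.tsum_eq]
    exact h3.summable.tsum_pos (fun l => (Real.exp_pos _).le) 0 (Real.exp_pos _)
  intro h5
  rw [h5] at h4
  simp at h4

noncomputable def PP (N : ℕ) (m : ℤ) (j : Fin N) : ℂ := (j:ℕ)/N - (N+m)/(2*N)

lemma ff_P {N : ℕ} (m : ℤ) {h : ℝ} (hh : 0 < h) (j k : Fin N) :
    ff N (N+m) h k (PP N m j) = cexp (-Real.pi*I*(j:ℕ)) *
     ((cexp (2*Real.pi*I*((k:ℕ)-N/2)*(-(N+m)/(2*N))) * (cexp (-h*((k:ℕ)-N/2)^2/(2*N)) *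
      JJ (N*h) (-(Real.exp (-h*(k:ℕ)):ℂ)))) * (cexp (2*Real.pi*I/N)^(j:ℕ))^(k:ℕ)) := by
  have hN : 0 < N := k.pos
  have hN' : (N:ℂ) ≠ 0 := by exact_mod_cast hN.ne'
  have hNh : 0 < N*h := by positivity
  have hne : -(Real.exp (-h*(k:ℕ)) : ℂ) ≠ 0 := by
    rw [neg_ne_zero]; exact_mod_cast (Real.exp_pos _).ne'
  have h1 := (JJ_summ hNh hne).hasSum.mul_left (cexp (-Real.pi*I*(j:ℕ)) *
     (cexp (2*Real.pi*I*((k:ℕ)-N/2)*(-(N+m)/(2*N))) * cexp (-h*((k:ℕ)-N/2)^2/(2*N))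
       * (cexp (2*Real.pi*I/N)^(j:ℕ))^(k:ℕ)))
  refine (ff_summ (N+m) hh k (PP N m j)).hasSum.unique (hs_congr h1 (fun l => ?_) ?_)
  · rw [tc_neg_exp, ← Complex.exp_nat_mul, ← Complex.exp_nat_mul]
    push_cast
    have : ∀ z, cexp z = cexp z * cexp (((-l*(j:ℕ) : ℤ):ℂ) * (2*Real.pi*I)) := by
      intro z; rw [Complex.exp_int_mul_two_pi_mul_I, mul_one]
    rw [this]
    simp only [← Complex.exp_add]
    congr 1
    simp only [ffe, PP]
    push_cast
    field_simp
    ring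
  · rw [← JJ]; ring

lemma sum_sq (N : ℕ) : ∑ k ∈ Finset.range N, ((k:ℂ)-N/2)^2 = (N:ℂ)*((N:ℂ)^2+2)/12 := by
  have : ∀ (c : ℂ) (n : ℕ), ∑ k ∈ Finset.range n, ((k:ℂ)-c)^2 =
      (n:ℂ)*(n-1)*(2*n-1)/6 - c * n*(n-1) + n*c^2 := by
    intro c n
    induction n with
    | zero => simp
    | succ n ih => rw [Finset.sum_range_succ, ih]; push_cast; ring
  rw [this]; ring

lemma Dt_P {N : ℕ} (hN : 0 < N) (m : ℤ) : ∃ K : ℂ, K ≠ 0 ∧ ∀ h : ℝ, 0 < h →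
    Dt (N+m) h (PP N m) = K * cexp (-h*(N^2+2)/24) * ∏ k : Fin N, JJ (N*h) (-(Real.exp (-h*(k:ℕ)):ℂ)) := by
  refine ⟨(∏ j : Fin N, cexp (-Real.pi*I*(j:ℕ))) *
    ((∏ k : Fin N, cexp (2*Real.pi*I*((k:ℕ)-N/2)*(-(N+m)/(2*N)))) *
     (Matrix.vandermonde (fun j : Fin N => cexp (2*Real.pi*I/N)^(j:ℕ))).det), ?_, fun h hh => ?_⟩
  · refine mul_ne_zero (Finset.prod_ne_zero_iff.2 fun _ _ => Complex.exp_ne_zero _)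
      (mul_ne_zero (Finset.prod_ne_zero_iff.2 fun _ _ => Complex.exp_ne_zero _) ?_)
    rw [Matrix.det_vandermonde_ne_zero_iff]
    intro j k hjk
    exact Fin.ext ((Complex.isPrimitiveRoot_exp N hN.ne').pow_inj j.2 k.2 hjk)
  · have e1 : (Matrix.of fun j k : Fin N => ff N (N+m) h k (PP N m j)) =
      Matrix.of fun j k : Fin N => cexp (-Real.pi*I*(j:ℕ)) * (Matrix.of fun j k : Fin N =>
        ((cexp (2*Real.pi*I*((k:ℕ)-N/2)*(-(N+m)/(2*N))) * (cexp (-h*((k:ℕ)-N/2)^2/(2*N)) *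
      JJ (N*h) (-(Real.exp (-h*(k:ℕ)):ℂ)))) *
      (Matrix.vandermonde (fun j : Fin N => cexp (2*Real.pi*I/N)^(j:ℕ))) j k)) j k := by
      ext j k
      simp only [Matrix.of_apply, Matrix.vandermonde_apply]
      exact ff_P m hh j k
    rw [Dt, e1, Matrix.det_mul_column, Matrix.det_mul_row, Finset.prod_mul_distrib, Finset.prod_mul_distrib]
    have e2 : ∏ k : Fin N, cexp (-h*((k:ℕ)-N/2)^2/(2*N)) = cexp (-h*(N^2+2)/24) := by
      rw [← Complex.exp_sum, Fin.sum_univ_eq_sum_range (fun k => -(h:ℂ)*((k:ℂ)-N/2)^2/(2*N)),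
        ← Finset.sum_div, ← Finset.mul_sum, sum_sq]
      congr 1
      have hN' : (N:ℂ) ≠ 0 := by exact_mod_cast hN.ne'
      field_simp
      ring
    rw [e2]
    ring

lemma Th_P {N : ℕ} (hN : 0 < N) (m : ℤ) : ∃ K : ℂ, K ≠ 0 ∧ ∀ h : ℝ, 0 < h →
    Th h (m/2) (PP N m) = K * cexp (-h/8) ^ (N*(N-1)/2+1) * JJ h (-1) *
      ∏ j : Fin N, ∏ k ∈ Finset.Ioi j, JJ h (uu N j k) := by
  have hN' : (N:ℂ) ≠ 0 := by exact_mod_cast hN.ne'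
  refine ⟨(I * cexp (-Real.pi * I * (-1/2))) * ∏ j : Fin N, ∏ k ∈ Finset.Ioi j,
    (I * cexp (-Real.pi * I * (PP N m j - PP N m k))), ?_, fun h hh => ?_⟩
  · refine mul_ne_zero (mul_ne_zero I_ne_zero (Complex.exp_ne_zero _)) ?_
    exact Finset.prod_ne_zero_iff.2 fun _ _ => Finset.prod_ne_zero_iff.2 fun _ _ =>
      mul_ne_zero I_ne_zero (Complex.exp_ne_zero _)
  · have e0 : (m:ℂ)/2 + ∑ j, PP N m j = -1/2 := by
      simp only [PP]
      rw [Finset.sum_sub_distrib, ← Finset.sum_div, Fin.sum_univ_eq_sum_range (fun j => (j:ℂ))]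
      have : ∀ n : ℕ, ∑ j ∈ Finset.range n, (j:ℂ) = n*(n-1)/2 := by
        intro n
        induction n with
        | zero => simp
        | succ n ih => rw [Finset.sum_range_succ, ih]; push_cast; ring
      rw [this]
      simp only [Finset.sum_const, Finset.card_univ, Fintype.card_fin, nsmul_eq_mul]
      field_simp
      ring
    rw [Th, e0]
    simp_rw [th_JJ hh]
    have e1 : cexp (2*Real.pi*I*(-1/2)) = -1 := by
      rw [show 2*Real.pi*I*(-1/2) = -(Real.pi*I) by ring, Complex.exp_neg, Complex.exp_pi_mul_I]; norm_num
    have e2 : ∀ j k : Fin N, cexp (2*Real.pi*I*(PP N m j - PP N m k)) = uu N j k := by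
      intro j k; rw [uu, PP, PP]; congr 1; ring
    simp_rw [e1, e2, Finset.prod_mul_distrib]
    have e3 : (∏ j : Fin N, ∏ k ∈ Finset.Ioi j, cexp (-h/8)) = cexp (-h/8) ^ (N*(N-1)/2) := by
      simp only [Finset.prod_const]
      rw [Finset.prod_pow_eq_pow_sum, pairs_card]
    rw [e3]
    ring

lemma nat_aux {N : ℕ} (hN : 0 < N) : N*(N-1)/2 = (N-1)*(N-2)/2 + (N-1) := by
  obtain ⟨n, rfl⟩ : ∃ n, N = n+1 := ⟨N-1, by omega⟩
  rcases n with _ | n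
  · rfl
  · have : (n+1+1)*(n+1+1-1) = (n+1+1-1)*(n+1+1-2) + (n+1+1-1)*2 := by
      simp only [Nat.add_sub_cancel]
      have : n+1+1-2 = n := by omega
      rw [this]; ring
    rw [this, Nat.add_mul_div_right _ _ (by norm_num)]

lemma const_P {N : ℕ} (hN : 0 < N) (m : ℤ) : ∃ K : ℂ, K ≠ 0 ∧ ∀ h : ℝ, 0 < h →
    Dt (N+m) h (PP N m) ≠ 0 ∧
    Th h (m/2) (PP N m) = K * (Real.exp (-h/24) * EE h : ℝ)^((N-1)*(N-2)/2) * Dt (N+m) h (PP N m) := by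
  obtain ⟨K1, hK1, H1⟩ := Th_P hN m
  obtain ⟨K2, hK2, H2⟩ := Dt_P hN m
  obtain ⟨K3, hK3, H3⟩ := E2 N hN
  refine ⟨K1*K3/K2, by positivity, fun h hh => ⟨?_, ?_⟩⟩
  · rw [H2 h hh]
    refine mul_ne_zero (mul_ne_zero hK2 (Complex.exp_ne_zero _)) (Finset.prod_ne_zero_iff.2 fun k _ => ?_)
    exact JJ_neg_ne (by positivity) _
  · have h3 := H3 h hh
    have h4 := E1 hN hh
    have hE : (EE h : ℂ) ≠ 0 := by exact_mod_cast (EE_pos hh).ne'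
    rw [H1 h hh, H2 h hh]
    have hx : cexp (-h/8) ^ (N*(N-1)/2+1) = cexp (-h/24)^((N-1)*(N-2)/2) * cexp (-h*(N^2+2)/24) := by
      rw [← Complex.exp_nat_mul, ← Complex.exp_nat_mul, ← Complex.exp_add]
      congr 1
      have a1 : ((N*(N-1)/2 : ℕ):ℂ) = ((N-1)*(N-2)/2 : ℕ) + ((N:ℂ)-1) := by
        rw [nat_aux hN]; push_cast [Nat.cast_sub (by omega : 1 ≤ N)]; ring
      have a2 : ((N*(N-1)/2 : ℕ):ℂ) * 2 = N*((N:ℂ)-1) := by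
        have : N*(N-1)/2*2 = N*(N-1) := Nat.div_mul_cancel (Nat.even_mul_pred_self N).two_dvd
        have := congrArg (Nat.cast : ℕ → ℂ) this
        push_cast [Nat.cast_sub (by omega : 1 ≤ N)] at this
        exact_mod_cast this
      push_cast only [Nat.cast_add, Nat.cast_one]
      linear_combination (-(h:ℂ)/24) * a1 - (h:ℂ)/24 * a2
    rw [hx]
    rw [nat_aux hN] at h3
    have hNs : N = (N-1)+1 := by omega
    have hp : (EE h:ℂ)^N = EE h ^ (N-1) * EE h := by
      conv_lhs => rw [hNs]
      rw [pow_succ]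
    refine mul_right_cancel₀ (pow_ne_zero N hE) ?_
    generalize (∏ k : Fin N, JJ (N*h) (-(Real.exp (-h*(k:ℕ)):ℂ))) = PJ at h4 ⊢
    push_cast
    rw [mul_assoc _ _ ((EE h:ℂ)^N), h3, hp, pow_add, mul_pow]
    field_simp
    linear_combination (-1) * h4


lemma integrable_tsum_aux {F : ℤ → ℝ → ℂ} (hs : ∀ y, Summable fun i => F i y)
    (hF_int : ∀ i, MeasureTheory.Integrable (F i)) (hF_sum : Summable fun i ↦ ∫ a, ‖F i a‖) :
    MeasureTheory.Integrable (fun y => ∑' i, F i y) := by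
  refine ⟨?_, ?_⟩
  · refine aestronglyMeasurable_of_tendsto_ae (atTop : Filter (Finset ℤ))
      (f := fun s y => ∑ i ∈ s, F i y) (fun s => ?_) (Eventually.of_forall fun y => (hs y).hasSum)
    exact (MeasureTheory.integrable_finsetSum s (fun i _ => hF_int i)).1
  · have this (i : ℤ) : ∫⁻ a, ‖F i a‖ₑ = ‖∫ a, ‖F i a‖‖ₑ := by
      dsimp [enorm]
      rw [MeasureTheory.lintegral_coe_eq_integral _ (hF_int i).norm, ENNReal.coe_nnreal_eq, coe_nnnorm,
        Real.norm_of_nonneg (MeasureTheory.integral_nonneg (fun a ↦ norm_nonneg (F i a)))]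
      simp only [coe_nnnorm]
    have h2 : ∑' i, ∫⁻ a, ‖F i a‖ₑ ≠ ⊤ := by
      rw [funext this]
      exact ENNReal.tsum_coe_ne_top_iff_summable.2 <| NNReal.summable_coe.1 hF_sum.abs
    rw [← MeasureTheory.lintegral_tsum (fun i => (hF_int i).1.enorm)] at h2
    refine lt_of_le_of_lt (MeasureTheory.lintegral_mono fun y => ?_) (lt_top_iff_ne_top.2 h2)
    exact enorm_tsum_le_tsum_enorm

lemma gauss_real {t : ℝ} (ht : 0 < t) (a : ℝ) :
    MeasureTheory.Integrable (fun y : ℝ => Real.exp (-y^2/(2*t)) / Real.sqrt (2*Real.pi*t) * Real.exp (a*y)) ∧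
    ∫ y : ℝ, Real.exp (-y^2/(2*t)) / Real.sqrt (2*Real.pi*t) * Real.exp (a*y) = Real.exp (a^2*t/2) := by
  have hb : 0 < 1/(2*t) := by positivity
  have e : (fun y : ℝ => Real.exp (-y^2/(2*t)) / Real.sqrt (2*Real.pi*t) * Real.exp (a*y)) =
      fun y => Real.exp (a^2*t/2) / Real.sqrt (2*Real.pi*t) * Real.exp (-(1/(2*t)) * (y - a*t)^2) := by
    funext y
    rw [div_mul_eq_mul_div, div_mul_eq_mul_div, ← Real.exp_add, ← Real.exp_add]
    congr 2
    field_simp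
    ring
  have hs : Real.sqrt (2*Real.pi*t) ≠ 0 := by positivity
  rw [e]
  refine ⟨((integrable_exp_neg_mul_sq hb).comp_sub_right (a*t)).const_mul _, ?_⟩
  rw [MeasureTheory.integral_const_mul,
    MeasureTheory.integral_sub_right_eq_self (fun y => Real.exp (-(1/(2*t)) * y^2)) (a*t), integral_gaussian,
    show Real.pi/(1/(2*t)) = 2*Real.pi*t by field_simp]
  field_simp

lemma gauss_ff {N : ℕ} (e : ℤ) {r t ts : ℝ} (hr : 0 < r) (ht : 0 < t) (hts : t < ts) (k : Fin N) (w : ℝ) :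
    MeasureTheory.Integrable (fun y : ℝ => ((Real.exp (-y^2/(2*t)) / Real.sqrt (2*Real.pi*t) : ℝ) : ℂ) *
      ff N e (N*ts/r^2) k ((w + I*y)/(2*Real.pi*r))) ∧
    ∫ y : ℝ, ((Real.exp (-y^2/(2*t)) / Real.sqrt (2*Real.pi*t) : ℝ) : ℂ) *
      ff N e (N*ts/r^2) k ((w + I*y)/(2*Real.pi*r)) = ff N e (N*(ts-t)/r^2) k (w/(2*Real.pi*r)) := by
  have hN : 0 < N := k.pos
  have hN' : (N:ℂ) ≠ 0 := by exact_mod_cast hN.ne'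
  have hr' : (r:ℂ) ≠ 0 := by exact_mod_cast hr.ne'
  have hpi : (Real.pi:ℂ) ≠ 0 := by exact_mod_cast Real.pi_ne_zero
  have h1 : 0 < N*ts/r^2 := by have := ht.trans hts; positivity
  have h2 : 0 < N*(ts-t)/r^2 := by have := sub_pos.2 hts; positivity
  set a : ℤ → ℝ := fun l => -(((k:ℕ):ℝ)+N*l-N/2)/r with ha
  set C : ℤ → ℂ := fun l => cexp (ffe N e (N*ts/r^2) k (w/(2*Real.pi*r)) l) with hC
  set F : ℤ → ℝ → ℂ := fun l y => ((Real.exp (-y^2/(2*t)) / Real.sqrt (2*Real.pi*t) : ℝ) : ℂ) *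
      cexp (ffe N e (N*ts/r^2) k ((w + I*y)/(2*Real.pi*r)) l) with hF
  have eF : ∀ l y, F l y = C l * ((Real.exp (-y^2/(2*t)) / Real.sqrt (2*Real.pi*t) * Real.exp (a l*y) : ℝ):ℂ) := by
    intro l y
    simp only [hF, hC]
    rw [Complex.ofReal_mul, mul_left_comm, Complex.ofReal_exp (a l * y), ← Complex.exp_add]
    congr 2
    simp only [ffe, ha]
    push_cast
    field_simp
    ring_nf
    rw [Complex.I_sq]
    ring
  have eC : ∀ l, C l * ((Real.exp (a l^2*t/2) : ℝ) : ℂ) = cexp (ffe N e (N*(ts-t)/r^2) k (w/(2*Real.pi*r)) l) := by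
    intro l
    rw [Complex.ofReal_exp, ← Complex.exp_add]
    congr 1
    simp only [ffe, ha]
    push_cast
    field_simp
    ring
  have hi : ∀ l, MeasureTheory.Integrable (F l) := by
    intro l
    rw [funext (eF l)]
    exact (gauss_real ht (a l)).1.ofReal.const_mul _
  have hI : ∀ l, ∫ y, F l y = cexp (ffe N e (N*(ts-t)/r^2) k (w/(2*Real.pi*r)) l) := by
    intro l
    simp_rw [eF]
    rw [MeasureTheory.integral_const_mul, integral_complex_ofReal, (gauss_real ht (a l)).2, eC]
  have hn : ∀ l, ∫ y, ‖F l y‖ = ‖cexp (ffe N e (N*(ts-t)/r^2) k (w/(2*Real.pi*r)) l)‖ := by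
    intro l
    have : ∀ y, ‖F l y‖ = ‖C l‖ * (Real.exp (-y^2/(2*t)) / Real.sqrt (2*Real.pi*t) * Real.exp (a l*y)) := by
      intro y
      rw [eF, norm_mul, Complex.norm_real, Real.norm_of_nonneg (by positivity)]
    simp_rw [this]
    rw [MeasureTheory.integral_const_mul, (gauss_real ht (a l)).2, ← eC, norm_mul, Complex.norm_real,
      Real.norm_of_nonneg (by positivity)]
  have hsn : Summable fun l => ∫ y, ‖F l y‖ := by
    simp_rw [hn]
    exact (ff_summ e h2 k _).norm
  have hs : ∀ y, Summable fun l => F l y := fun y => (ff_summ e h1 k _).mul_left _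
  have eq : (fun y : ℝ => ((Real.exp (-y^2/(2*t)) / Real.sqrt (2*Real.pi*t) : ℝ) : ℂ) *
      ff N e (N*ts/r^2) k ((w + I*y)/(2*Real.pi*r))) = fun y => ∑' l, F l y := by
    funext y
    rw [ff, ← tsum_mul_left]
  rw [eq]
  refine ⟨integrable_tsum_aux hs hi hsn, ?_⟩
  rw [← MeasureTheory.integral_tsum_of_summable_integral_norm hi hsn]
  simp_rw [hI]
  rfl

lemma gauss_Dt {N : ℕ} (e : ℤ) {r t ts : ℝ} (hr : 0 < r) (ht : 0 < t) (hts : t < ts) (w : Fin N → ℝ) :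
    ∫ y : Fin N → ℝ, ((∏ j, Real.exp (-(y j)^2/(2*t)) / Real.sqrt (2*Real.pi*t) : ℝ) : ℂ) *
      Dt e (N*ts/r^2) (fun j => (w j + I*y j)/(2*Real.pi*r)) =
    Dt e (N*(ts-t)/r^2) (fun j : Fin N => (w j : ℂ)/(2*Real.pi*r)) := by
  have h1 : ∀ y : Fin N → ℝ, ((∏ j, Real.exp (-(y j)^2/(2*t)) / Real.sqrt (2*Real.pi*t) : ℝ) : ℂ) *
      Dt e (N*ts/r^2) (fun j => (w j + I*y j)/(2*Real.pi*r)) =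
      ∑ σ : Equiv.Perm (Fin N), ((Equiv.Perm.sign σ : ℤ) : ℂ) *
       ∏ j, (((Real.exp (-(y j)^2/(2*t)) / Real.sqrt (2*Real.pi*t) : ℝ) : ℂ) *
          ff N e (N*ts/r^2) (σ j) ((w j + I*y j)/(2*Real.pi*r))) := by
    intro y
    rw [Dt, ← Matrix.det_transpose, Matrix.det_apply', Finset.mul_sum]
    refine Finset.sum_congr rfl fun σ _ => ?_
    rw [Finset.prod_mul_distrib, Complex.ofReal_prod]
    simp only [Matrix.transpose_apply, Matrix.of_apply]
    ring
  simp_rw [h1]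
  have hint : ∀ σ : Equiv.Perm (Fin N), MeasureTheory.Integrable (fun y : Fin N → ℝ =>
      ∏ j, (((Real.exp (-(y j)^2/(2*t)) / Real.sqrt (2*Real.pi*t) : ℝ) : ℂ) *
          ff N e (N*ts/r^2) (σ j) ((w j + I*y j)/(2*Real.pi*r)))) := fun σ =>
    MeasureTheory.Integrable.fintype_prod (f := fun j (x : ℝ) =>
      (((Real.exp (-x^2/(2*t)) / Real.sqrt (2*Real.pi*t) : ℝ) : ℂ) *
          ff N e (N*ts/r^2) (σ j) ((w j + I*x)/(2*Real.pi*r)))) (fun j => (gauss_ff e hr ht hts (σ j) (w j)).1)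
  rw [MeasureTheory.integral_finsetSum _ (fun σ _ => (hint σ).const_mul _)]
  rw [Dt, ← Matrix.det_transpose, Matrix.det_apply']
  refine Finset.sum_congr rfl fun σ _ => ?_
  rw [MeasureTheory.integral_const_mul, MeasureTheory.integral_fintype_prod_volume_eq_prod (fun j (x : ℝ) =>
      (((Real.exp (-x^2/(2*t)) / Real.sqrt (2*Real.pi*t) : ℝ) : ℂ) *
          ff N e (N*ts/r^2) (σ j) ((w j + I*x)/(2*Real.pi*r))))]
  congr 1
  refine Finset.prod_congr rfl fun j _ => ?_
  rw [(gauss_ff e hr ht hts (σ j) (w j)).2]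
  rfl

lemma prod_ite_Ioi {N : ℕ} (f : Fin N → Fin N → ℂ) :
    (∏ j : Fin N, ∏ k : Fin N, if j < k then f j k else 1) = ∏ j : Fin N, ∏ k ∈ Finset.Ioi j, f j k := by
  refine Finset.prod_congr rfl fun j _ => ?_
  rw [← Finset.prod_filter]
  congr 1
  ext k
  simp

lemma final_aux {N : ℕ} (hN : 0 < N) {r t ts : ℝ} (hr : 0 < r) (ht : 0 < t) (hts : t < ts)
    (m : ℤ) (w : Fin N → ℝ) :
    ∫ y : Fin N → ℝ, ((∏ j, Real.exp (-(y j)^2/(2*t)) / Real.sqrt (2*Real.pi*t) : ℝ) : ℂ) *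
      Th (N*ts/r^2) (m/2) (fun j => (w j + I*y j)/(2*Real.pi*r)) =
    ((Real.exp ((N : ℝ) * t / (24 * r ^ 2)) *
          ∏' n : ℕ, (1 - Real.exp (-(((n : ℝ) + 1) * N * (ts - t)) / r ^ 2)) /
            (1 - Real.exp (-(((n : ℝ) + 1) * N * ts) / r ^ 2)) : ℝ) : ℂ) ^
          (-((((N - 1) * (N - 2) / 2 : ℕ)) : ℤ)) *
    Th (N*(ts-t)/r^2) (m/2) (fun j : Fin N => (w j : ℂ)/(2*Real.pi*r)) := by
  have h1 : 0 < N*ts/r^2 := by have := ht.trans hts; positivity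
  have h2 : 0 < N*(ts-t)/r^2 := by have := sub_pos.2 hts; positivity
  obtain ⟨K, hK, H⟩ := const_P hN m
  have key : ∀ h : ℝ, 0 < h → ∀ x : Fin N → ℂ, Th h (m/2) x =
      K * (Real.exp (-h/24) * EE h : ℝ)^((N-1)*(N-2)/2) * Dt (N+m) h x := by
    intro h hh x
    obtain ⟨a, b⟩ := H h hh
    have := Th_Dt hh m (PP N m) a x
    rw [b] at this
    refine mul_right_cancel₀ a ?_
    rw [this]; ring
  simp_rw [key _ h1, key _ h2]
  have : ∀ y : Fin N → ℝ, ((∏ j, Real.exp (-(y j)^2/(2*t)) / Real.sqrt (2*Real.pi*t) : ℝ) : ℂ) *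
     (K * (Real.exp (-(N*ts/r^2)/24) * EE (N*ts/r^2) : ℝ)^((N-1)*(N-2)/2) *
       Dt (N+m) (N*ts/r^2) (fun j => (w j + I*y j)/(2*Real.pi*r))) =
     (K * (Real.exp (-(N*ts/r^2)/24) * EE (N*ts/r^2) : ℝ)^((N-1)*(N-2)/2)) *
     (((∏ j, Real.exp (-(y j)^2/(2*t)) / Real.sqrt (2*Real.pi*t) : ℝ) : ℂ) *
       Dt (N+m) (N*ts/r^2) (fun j => (w j + I*y j)/(2*Real.pi*r))) := fun y => by ring
  simp_rw [this]
  rw [MeasureTheory.integral_const_mul, gauss_Dt _ hr ht hts]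
  have hp : ∏' n : ℕ, (1 - Real.exp (-(((n : ℝ) + 1) * N * (ts - t)) / r ^ 2)) /
            (1 - Real.exp (-(((n : ℝ) + 1) * N * ts) / r ^ 2)) = EE (N*(ts-t)/r^2) / EE (N*ts/r^2) := by
    rw [EE, EE, ← Multipliable.tprod_div₀ (mult_fac h2) (mult_fac h1) (EE_pos h1).ne']
    refine tprod_congr fun n => ?_
    congr 3
    · congr 1; ring
    · congr 1; ring
  have hr' : Real.exp ((N : ℝ) * t / (24 * r ^ 2)) * (EE (N*(ts-t)/r^2) / EE (N*ts/r^2)) =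
      (Real.exp (-(N*(ts-t)/r^2)/24) * EE (N*(ts-t)/r^2)) / (Real.exp (-(N*ts/r^2)/24) * EE (N*ts/r^2)) := by
    rw [mul_div_mul_comm (Real.exp (-(N*(ts-t)/r^2)/24)), ← Real.exp_sub]
    congr 2
    field_simp
    ring
  rw [hp, hr']
  have p1 : 0 < Real.exp (-(N*ts/r^2)/24) * EE (N*ts/r^2) := mul_pos (Real.exp_pos _) (EE_pos h1)
  have p2 : 0 < Real.exp (-(N*(ts-t)/r^2)/24) * EE (N*(ts-t)/r^2) := mul_pos (Real.exp_pos _) (EE_pos h2)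
  generalize Real.exp (-(N*ts/r^2)/24) * EE (N*ts/r^2) = A at p1 ⊢
  generalize Real.exp (-(N*(ts-t)/r^2)/24) * EE (N*(ts-t)/r^2) = B at p2 ⊢
  have q1 : (A:ℂ) ≠ 0 := by exact_mod_cast p1.ne'
  have q2 : (B:ℂ) ≠ 0 := by exact_mod_cast p2.ne'
  rw [zpow_neg, zpow_natCast, Complex.ofReal_div, div_pow]
  field_simp


end Helpers

theorem stmt_11 (N : ℕ) (hN : 2 ≤ N) (r : ℝ) (hr : 0 < r) (δ : ℝ)
    (hδ : ∃ m : ℤ, δ = Real.pi * r * m) (t tstar : ℝ) (ht : 0 < t) (htt : t < tstar)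
    (w : Fin N → ℝ) :
    (∫ wt : Fin N → ℝ,
        ((∏ j, Real.exp (-(wt j) ^ 2 / (2 * t)) / Real.sqrt (2 * Real.pi * t) : ℝ) : ℂ) *
          (theta1 (((δ : ℂ) + ∑ j, (((w j : ℝ) : ℂ) + Complex.I * (wt j))) / (2 * Real.pi * r))
              (Complex.I * N * tstar / (2 * Real.pi * r ^ 2)) *
            ∏ j : Fin N, ∏ k : Fin N, if j < k then
              theta1 (((((w j : ℝ) : ℂ) + Complex.I * (wt j)) -
                  (((w k : ℝ) : ℂ) + Complex.I * (wt k))) / (2 * Real.pi * r))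
                (Complex.I * N * tstar / (2 * Real.pi * r ^ 2)) else 1)) =
      ((Real.exp ((N : ℝ) * t / (24 * r ^ 2)) *
          ∏' n : ℕ, (1 - Real.exp (-(((n : ℝ) + 1) * N * (tstar - t)) / r ^ 2)) /
            (1 - Real.exp (-(((n : ℝ) + 1) * N * tstar) / r ^ 2)) : ℝ) : ℂ) ^
          (-((((N - 1) * (N - 2) / 2 : ℕ)) : ℤ)) *
        theta1 ((((δ + ∑ j, w j) / (2 * Real.pi * r) : ℝ)) : ℂ)
          (Complex.I * N * (tstar - t) / (2 * Real.pi * r ^ 2)) *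
        ∏ j : Fin N, ∏ k : Fin N, if j < k then
          theta1 ((((w j - w k) / (2 * Real.pi * r) : ℝ)) : ℂ)
            (Complex.I * N * (tstar - t) / (2 * Real.pi * r ^ 2)) else 1 := by
  obtain ⟨m, rfl⟩ := hδ
  have hr' : (r : ℂ) ≠ 0 := by exact_mod_cast hr.ne'
  have hpi : (Real.pi : ℂ) ≠ 0 := by exact_mod_cast Real.pi_ne_zero
  have hmain := final_aux (by omega : 0 < N) hr ht htt m w
  have tau1 : Complex.I * N * tstar / (2 * Real.pi * r ^ 2) =
      Complex.I * ((N * tstar / r ^ 2 : ℝ) : ℂ) / (2 * Real.pi) := by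
    push_cast; field_simp
  have tau2 : Complex.I * N * (tstar - t) / (2 * Real.pi * r ^ 2) =
      Complex.I * ((N * (tstar - t) / r ^ 2 : ℝ) : ℂ) / (2 * Real.pi) := by
    push_cast; field_simp
  have gen : ∀ (h : ℝ) (z : Fin N → ℂ),
      theta1 ((((Real.pi * r * m : ℝ) : ℂ) + ∑ j, z j) / (2 * Real.pi * r))
        (Complex.I * (h : ℂ) / (2 * Real.pi)) *
      (∏ j : Fin N, ∏ k : Fin N, if j < k then
        theta1 ((z j - z k) / (2 * Real.pi * r)) (Complex.I * (h : ℂ) / (2 * Real.pi)) else 1) =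
      Th h (m / 2) (fun j => z j / (2 * Real.pi * r)) := by
    intro h z
    rw [prod_ite_Ioi, Th, ← Finset.sum_div]
    have e1 : ((((Real.pi * r * m : ℝ) : ℂ) + ∑ j, z j) / (2 * Real.pi * r)) =
        (m : ℂ) / 2 + (∑ j, z j) / (2 * Real.pi * r) := by
      push_cast; field_simp
    simp_rw [e1, sub_div, th]
  have e2 : ((((Real.pi * r * m + ∑ j, w j) / (2 * Real.pi * r) : ℝ)) : ℂ) =
      (((Real.pi * r * m : ℝ) : ℂ) + ∑ j, ((w j : ℝ) : ℂ)) / (2 * Real.pi * r) := by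
    push_cast; rfl
  have e3 : ∀ j k, ((((w j - w k) / (2 * Real.pi * r) : ℝ)) : ℂ) =
      (((w j : ℝ) : ℂ) - ((w k : ℝ) : ℂ)) / (2 * Real.pi * r) := by
    intro j k; push_cast; rfl
  rw [tau1, tau2, e2]
  simp_rw [e3]
  refine Eq.trans ?_ (mul_assoc _ _ _).symm
  rw [gen (N * (tstar - t) / r ^ 2) (fun j => ((w j : ℝ) : ℂ)), ← hmain]
  refine MeasureTheory.integral_congr_ae (Filter.Eventually.of_forall fun y => ?_)
  exact congrArg _ (gen (N * tstar / r ^ 2) (fun j => ((w j : ℝ) : ℂ) + Complex.I * (y j)))
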